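/- Suppose α is an isophote with axis d and angle θ, κ(s) > 0 for all s, k_n(s) = 0 for all s (α is an asymptotic curve), and τ_g(s) ≠ 0 for all s. Then the function s ↦ ⟪T(s), d⟫ is constant with ⟪T(s), d⟫² = sin²θ for all s (so α is a general helix with axis d), ⟪b(s), d⟫² = cos²θ for all s, and κ(s)²·sin²θ = τ(s)²·cos²θ for all s (so τ/κ is constant). -/

import Mathlib

open scoped RealInnerProductSpace

noncomputable section

/-- The cross product on `EuclideanSpace ℝ (Fin 3)`. -/
def cross3 (u v : EuclideanSpace ℝ (Fin 3)) : EuclideanSpace ℝ (Fin 3) :=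
  (EuclideanSpace.equiv (Fin 3) ℝ).symm
    (crossProduct ((EuclideanSpace.equiv (Fin 3) ℝ) u) ((EuclideanSpace.equiv (Fin 3) ℝ) v))

theorem cross3_apply (u v : EuclideanSpace ℝ (Fin 3)) :
    cross3 u v = !₂[u 1 * v 2 - u 2 * v 1, u 2 * v 0 - u 0 * v 2, u 0 * v 1 - u 1 * v 0] := by
  ext i
  fin_cases i <;> simp [cross3, cross_apply]

theorem inner_fin_three (u v : EuclideanSpace ℝ (Fin 3)) :
    ⟪u, v⟫ = u 0 * v 0 + u 1 * v 1 + u 2 * v 2 := by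
  simp [PiLp.inner_apply, Fin.sum_univ_three, mul_comm]

/-- Expansion of an inner product in the orthogonal frame `u`, `v`, `u × v`. -/
theorem inner_eq_of_orthogonal {u v : EuclideanSpace ℝ (Fin 3)} (huv : ⟪u, v⟫ = 0)
    (x y : EuclideanSpace ℝ (Fin 3)) :
    ⟪u, u⟫ * ⟪v, v⟫ * ⟪x, y⟫ = ⟪v, v⟫ * (⟪x, u⟫ * ⟪y, u⟫) + ⟪u, u⟫ * (⟪x, v⟫ * ⟪y, v⟫) +
      ⟪cross3 u v, x⟫ * ⟪cross3 u v, y⟫ := by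
  have gram : ⟪cross3 u v, x⟫ * ⟪cross3 u v, y⟫ = ⟪u, u⟫ * ⟪v, v⟫ * ⟪x, y⟫ -
      ⟪v, v⟫ * (⟪x, u⟫ * ⟪y, u⟫) - ⟪u, u⟫ * (⟪x, v⟫ * ⟪y, v⟫) -
      ⟪u, v⟫ * (⟪u, v⟫ * ⟪x, y⟫ - ⟪x, u⟫ * ⟪y, v⟫ - ⟪x, v⟫ * ⟪y, u⟫) := by
    simp only [inner_fin_three, cross3_apply, Matrix.cons_val]
    ring
  rw [gram, huv]
  ring

theorem inner_cross3_self_left (u v : EuclideanSpace ℝ (Fin 3)) : ⟪cross3 u v, u⟫ = 0 := by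
  simp only [inner_fin_three, cross3_apply, Matrix.cons_val]
  ring

theorem cross3_smul_right (r : ℝ) (u v : EuclideanSpace ℝ (Fin 3)) :
    cross3 u (r • v) = r • cross3 u v := by
  simp [cross3]

theorem Differentiable.cross3 {f g : ℝ → EuclideanSpace ℝ (Fin 3)} (hf : Differentiable ℝ f)
    (hg : Differentiable ℝ g) : Differentiable ℝ fun s => cross3 (f s) (g s) := by
  rw [differentiable_euclidean] at hf hg ⊢
  intro i
  fin_cases i
  · simp only [cross3_apply]
    exact ((hf 1).mul (hg 2)).sub ((hf 2).mul (hg 1))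
  · simp only [cross3_apply]
    exact ((hf 2).mul (hg 0)).sub ((hf 0).mul (hg 2))
  · simp only [cross3_apply]
    exact ((hf 0).mul (hg 1)).sub ((hf 1).mul (hg 0))

/-- The product rule for two vector functions whose inner product is constant. -/
theorem inner_deriv_add_eq_zero {E : Type*} [NormedAddCommGroup E] [InnerProductSpace ℝ E]
    {f g : ℝ → E} (hf : Differentiable ℝ f) (hg : Differentiable ℝ g) {c : ℝ}
    (h : ∀ s, ⟪f s, g s⟫ = c) (s : ℝ) : ⟪f s, deriv g s⟫ + ⟪deriv f s, g s⟫ = 0 := by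
  rw [← deriv_inner_apply ℝ (hf s) (hg s), funext h, deriv_const]

theorem stmt5
    (α N : ℝ → EuclideanSpace ℝ (Fin 3))
    (hα : ContDiff ℝ (⊤ : ℕ∞) α) (hN : ContDiff ℝ (⊤ : ℕ∞) N)
    (hunit : ∀ s, ‖deriv α s‖ = 1)
    (hNunit : ∀ s, ‖N s‖ = 1)
    (hNT : ∀ s, ⟪N s, deriv α s⟫ = 0)
    (T B : ℝ → EuclideanSpace ℝ (Fin 3))
    (hT : ∀ s, T s = deriv α s)
    (hB : ∀ s, B s = cross3 (N s) (T s))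
    (kn kg τg : ℝ → ℝ)
    (hkn : ∀ s, kn s = ⟪deriv T s, N s⟫)
    (hkg : ∀ s, kg s = ⟪deriv T s, B s⟫)
    (hτg : ∀ s, τg s = ⟪deriv B s, N s⟫)
    (κ τ : ℝ → ℝ) (n b : ℝ → EuclideanSpace ℝ (Fin 3))
    (hκ : ∀ s, κ s = ‖deriv (deriv α) s‖)
    (hκpos : ∀ s, 0 < κ s)
    (hn : ∀ s, n s = (κ s)⁻¹ • deriv (deriv α) s)
    (hb : ∀ s, b s = cross3 (deriv α s) (n s))
    (hτ : ∀ s, τ s = ⟪cross3 (deriv α s) (deriv (deriv α) s), deriv (deriv (deriv α)) s⟫ / κ s ^ 2)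
    (d : EuclideanSpace ℝ (Fin 3)) (hd : ‖d‖ = 1) (θ : ℝ)
    (hiso : ∀ s, ⟪N s, d⟫ = Real.cos θ)
    (hasym : ∀ s, kn s = 0) (hτgne : ∀ s, τg s ≠ 0) :
    (∀ s t, ⟪T s, d⟫ = ⟪T t, d⟫) ∧ (∀ s, ⟪T s, d⟫ ^ 2 = Real.sin θ ^ 2) ∧
      (∀ s, ⟪b s, d⟫ ^ 2 = Real.cos θ ^ 2) ∧
      ∀ s, κ s ^ 2 * Real.sin θ ^ 2 = τ s ^ 2 * Real.cos θ ^ 2 := by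
  obtain rfl : T = deriv α := funext hT
  obtain rfl : B = fun s => cross3 (N s) (deriv α s) := funext hB
  have hT1 : ContDiff ℝ (⊤ : ℕ∞) (deriv α) := (contDiff_infty_iff_deriv.1 hα).2
  have hT2 : ContDiff ℝ (⊤ : ℕ∞) (deriv (deriv α)) := (contDiff_infty_iff_deriv.1 hT1).2
  have dT : Differentiable ℝ (deriv α) := (contDiff_infty_iff_deriv.1 hT1).1
  have dT' : Differentiable ℝ (deriv (deriv α)) := (contDiff_infty_iff_deriv.1 hT2).1
  have dN : Differentiable ℝ N := (contDiff_infty_iff_deriv.1 hN).1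
  have dB := dN.cross3 dT
  have dd : Differentiable ℝ fun _ : ℝ => d := differentiable_const d
  have hTT : ∀ s, ⟪deriv α s, deriv α s⟫ = 1 := fun s => by
    rw [real_inner_self_eq_norm_sq, hunit, one_pow]
  have hNN : ∀ s, ⟪N s, N s⟫ = 1 := fun s => by
    rw [real_inner_self_eq_norm_sq, hNunit, one_pow]
  have hdd : ⟪d, d⟫ = 1 := by rw [real_inner_self_eq_norm_sq, hd, one_pow]
  have hκκ : ∀ s, ⟪deriv (deriv α) s, deriv (deriv α) s⟫ = κ s ^ 2 := fun s => by
    rw [real_inner_self_eq_norm_sq, hκ]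
  have hT'N : ∀ s, ⟪deriv (deriv α) s, N s⟫ = 0 := fun s => by rw [← hkn, hasym]
  have hTT' : ∀ s, ⟪deriv α s, deriv (deriv α) s⟫ = 0 := fun s => by
    have h := inner_deriv_add_eq_zero dT dT hTT s
    rw [real_inner_comm (deriv α s)] at h
    linarith [real_inner_comm (deriv α s) (deriv (deriv α) s)]
  have hN'N : ∀ s, ⟪deriv N s, N s⟫ = 0 := fun s => by
    have h := inner_deriv_add_eq_zero dN dN hNN s
    linarith [real_inner_comm (N s) (deriv N s)]
  have hN'T : ∀ s, ⟪deriv N s, deriv α s⟫ = 0 := fun s => by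
    have h := inner_deriv_add_eq_zero dN dT hNT s
    linarith [real_inner_comm (N s) (deriv (deriv α) s), hT'N s]
  have hN'd : ∀ s, ⟪deriv N s, d⟫ = 0 := fun s => by
    simpa using inner_deriv_add_eq_zero dN dd hiso s
  have hBd : ∀ s, ⟪cross3 (N s) (deriv α s), d⟫ = 0 := fun s => by
    have h := inner_deriv_add_eq_zero dB dN (fun t => inner_cross3_self_left (N t) _) s
    have frame := inner_eq_of_orthogonal (hNT s) (deriv N s) d
    rw [hN'd, hN'N, hN'T, eq_neg_of_add_eq_zero_left h, ← hτg] at frame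
    simpa [hτgne s] using frame
  have hTd : ∀ s, ⟪deriv α s, d⟫ ^ 2 = Real.sin θ ^ 2 := fun s => by
    have frame := inner_eq_of_orthogonal (hNT s) d d
    rw [hNN, hTT, hdd, hBd, real_inner_comm (N s) d, real_inner_comm (deriv α s) d, hiso] at frame
    linarith [Real.sin_sq_add_cos_sq θ]
  have hT'd : ∀ s, ⟪deriv (deriv α) s, d⟫ = 0 := fun s => by
    have frame := inner_eq_of_orthogonal (hNT s) (deriv (deriv α) s) d
    rw [hNN, hTT, hBd, hT'N, real_inner_comm (deriv α s) (deriv (deriv α) s), hTT'] at frame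
    linarith
  have hcross : ∀ s, ⟪cross3 (deriv α s) (deriv (deriv α) s), d⟫ ^ 2 =
      κ s ^ 2 * Real.cos θ ^ 2 := fun s => by
    have frame := inner_eq_of_orthogonal (hTT' s) d d
    rw [hTT, hκκ, hdd, real_inner_comm (deriv α s) d, real_inner_comm (deriv (deriv α) s) d,
      hT'd] at frame
    rw [Real.cos_sq', ← hTd s]
    linarith
  refine ⟨fun s t => ?_, hTd, fun s => ?_, fun s => ?_⟩
  · refine is_const_of_deriv_eq_zero (f := fun r => ⟪deriv α r, d⟫) (dT.inner ℝ dd) (fun r => ?_) s t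
    rw [deriv_inner_apply ℝ (dT r) (dd r), hT'd, deriv_const, inner_zero_right, add_zero]
  · have hκ0 := (hκpos s).ne'
    rw [hb, hn, cross3_smul_right, real_inner_smul_left, mul_pow, hcross]
    field_simp
  · have hκ0 := (hκpos s).ne'
    have hT''d : ⟪deriv (deriv (deriv α)) s, d⟫ = 0 := by
      simpa using inner_deriv_add_eq_zero dT' dd hT'd s
    have hT''T : ⟪deriv (deriv (deriv α)) s, deriv α s⟫ = -κ s ^ 2 := by
      have h := inner_deriv_add_eq_zero dT dT' hTT' s
      rw [hκκ] at h
      linarith [real_inner_comm (deriv α s) (deriv (deriv (deriv α)) s)]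
    have frame := inner_eq_of_orthogonal (hTT' s) (deriv (deriv (deriv α)) s) d
    have hτ' : ⟪cross3 (deriv α s) (deriv (deriv α) s), deriv (deriv (deriv α)) s⟫ =
        τ s * κ s ^ 2 := by rw [hτ]; field_simp
    rw [hT''d, hκκ, hT''T, real_inner_comm (deriv α s) d, real_inner_comm (deriv (deriv α) s) d,
      hT'd, hτ'] at frame
    have key : κ s ^ 2 * ⟪deriv α s, d⟫ =
        τ s * ⟪cross3 (deriv α s) (deriv (deriv α) s), d⟫ :=
      mul_left_cancel₀ (pow_ne_zero 2 hκ0) (by linarith)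
    refine mul_left_cancel₀ (pow_ne_zero 2 hκ0) ?_
    calc κ s ^ 2 * (κ s ^ 2 * Real.sin θ ^ 2)
        = (κ s ^ 2 * ⟪deriv α s, d⟫) ^ 2 := by rw [← hTd s]; ring
      _ = κ s ^ 2 * (τ s ^ 2 * Real.cos θ ^ 2) := by rw [key, mul_pow, hcross]; ring
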